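/- Consider a θ-module sequence with pooling factors s_k ≥ 1, and suppose that for every 1 ≤ j ≤ N the maps M_j and P_j commute with the θ-translation T_u^θ for every u ∈ ℝⁿ. Then for every path q = (λ₁,…,λ_N) ∈ Λ^N, every t ∈ ℝⁿ and every f ∈ L²(ℝⁿ): U^θ[q](T_t^θ f) = e^{πi (t·t)(1 − 1/(s₁⋯s_N)²) cot θ} T^θ_{t/(s₁⋯s_N)} U^θ[q] f. -/

import Mathlib

noncomputable section

open MeasureTheory Complex
open scoped InnerProductSpace ENNReal

abbrev Rn (n : ℕ) : Type := EuclideanSpace ℝ (Fin n)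

variable {n : ℕ}

/-- θ-translation: `T_s^θ f (t) = e^{-2πi (s·(t-s)) cot θ} f (t-s)`. -/
def thetaTrans (θ : ℝ) (s : Rn n) (f : Rn n → ℂ) : Rn n → ℂ :=
  fun t => Complex.exp (((-2 * Real.pi * ⟪s, t - s⟫_ℝ * Real.cot θ : ℝ) : ℂ) * Complex.I) * f (t - s)

/-- Chirp modulation `C_θ f (t) = e^{πi (t·t) cot θ} f(t)`. -/
def chirp (θ : ℝ) (f : Rn n → ℂ) : Rn n → ℂ :=
  fun t => Complex.exp (((Real.pi * ⟪t, t⟫_ℝ * Real.cot θ : ℝ) : ℂ) * Complex.I) * f t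

/-- θ-convolution. -/
def thetaConv (θ : ℝ) (f g : Rn n → ℂ) : Rn n → ℂ :=
  fun x => ((|Real.sin θ| ^ (-(n : ℝ) / 2) : ℝ) : ℂ) * ∫ s, f s * thetaTrans θ s g x

/-- Unitary dilation. -/
def dil (r : ℝ) (f : Rn n → ℂ) : Rn n → ℂ :=
  fun x => ((r ^ ((n : ℝ) / 2) : ℝ) : ℂ) * f (r • x)

/-- θ-dilation `D_r^θ = C_{-θ} ∘ D_r ∘ C_θ`. -/
def thetaDil (θ r : ℝ) (f : Rn n → ℂ) : Rn n → ℂ := chirp (-θ) (dil r (chirp θ f))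

/-- Reflection `ǧ (x) = g (-x)`. -/
def reflFun (f : Rn n → ℂ) : Rn n → ℂ := fun x => f (-x)

/-- `L²` inner product (linear in the first argument). -/
def L2inner (f g : Rn n → ℂ) : ℂ := ∫ t, f t * (starRingEnd ℂ) (g t)

/-- Squared `L²` norm, as an extended nonnegative real. -/
def lNormSq (f : Rn n → ℂ) : ℝ≥0∞ := ∫⁻ t, (‖f t‖₊ : ℝ≥0∞) ^ 2

/-- The operator `U_k^θ[λ] f = D_{s_k}^θ P_k M_k (f ⋆_θ g_λ)` of the `k`-th network layer. -/
def layerU (θ : ℝ) {Λ : ℕ → Type} (g : ∀ k, Λ k → Rn n → ℂ)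
    (M P : ℕ → (Rn n → ℂ) → Rn n → ℂ) (s : ℕ → ℝ) (k : ℕ) (l : Λ k)
    (f : Rn n → ℂ) : Rn n → ℂ :=
  thetaDil θ (s k) (P k (M k (thetaConv θ f (g k l))))

/-- The path operator `U^θ[q] = U^θ[λ_N] ∘ ⋯ ∘ U^θ[λ₁]`. -/
def pathU (θ : ℝ) {Λ : ℕ → Type} (g : ∀ k, Λ k → Rn n → ℂ)
    (M P : ℕ → (Rn n → ℂ) → Rn n → ℂ) (s : ℕ → ℝ) :
    (N : ℕ) → (∀ j : Fin N, Λ j) → (Rn n → ℂ) → Rn n → ℂ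
  | 0, _, f => f
  | N + 1, q, f =>
      layerU θ g M P s N (q (Fin.last N)) (pathU θ g M P s N (fun j => q j.castSucc) f)

lemma thetaTrans_thetaTrans_neg (θ : ℝ) (u : Rn n) (h : Rn n → ℂ) :
    thetaTrans θ u (thetaTrans θ (-u) h) =
      fun x => exp (((2 * Real.pi * ⟪u, u⟫_ℝ * Real.cot θ : ℝ) : ℂ) * I) * h x := by
  funext x
  simp only [thetaTrans, sub_neg_eq_add, sub_add_cancel, ← mul_assoc, ← Complex.exp_add]
  congr 2
  simp only [inner_sub_right, inner_neg_left]
  push_cast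
  ring

/-- A map commuting with all θ-translations commutes with multiplication by the phases
`e^{πi a (t·t) cot θ}`, `a ≥ 0`, since these are compositions of two θ-translations. -/
lemma map_phase_mul_of_comm {θ : ℝ} {Q : (Rn n → ℂ) → Rn n → ℂ}
    (hQ : ∀ u h, Q (thetaTrans θ u h) = thetaTrans θ u (Q h))
    (t : Rn n) {a : ℝ} (ha : 0 ≤ a) (h : Rn n → ℂ) :
    Q (fun x => exp (((Real.pi * ⟪t, t⟫_ℝ * a * Real.cot θ : ℝ) : ℂ) * I) * h x) =
      fun x => exp (((Real.pi * ⟪t, t⟫_ℝ * a * Real.cot θ : ℝ) : ℂ) * I) * Q h x := by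
  have key : Real.pi * ⟪t, t⟫_ℝ * a * Real.cot θ =
      2 * Real.pi * ⟪√(a / 2) • t, √(a / 2) • t⟫_ℝ * Real.cot θ := by
    have hsq : √(a / 2) * √(a / 2) = a / 2 := Real.mul_self_sqrt (by positivity)
    rw [real_inner_smul_left, real_inner_smul_right, ← mul_assoc √(a / 2), hsq]
    ring
  rw [key, ← thetaTrans_thetaTrans_neg, ← thetaTrans_thetaTrans_neg, hQ, hQ]

lemma thetaConv_thetaTrans (θ : ℝ) (t : Rn n) (f g : Rn n → ℂ) :
    thetaConv θ (thetaTrans θ t f) g = thetaTrans θ t (thetaConv θ f g) := by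
  funext x
  simp only [thetaConv]
  rw [← integral_add_right_eq_self _ t]
  simp only [thetaTrans, thetaConv, add_sub_cancel_right]
  rw [mul_left_comm]
  congr 1
  rw [← integral_const_mul]
  congr 1
  funext s
  rw [mul_mul_mul_comm, ← Complex.exp_add, mul_left_comm (f s), ← mul_assoc (exp _) (exp _),
    ← Complex.exp_add, sub_sub x t s, add_comm t s, mul_assoc]
  congr 2
  simp only [inner_sub_right, inner_add_right, inner_add_left, real_inner_comm s t]
  push_cast
  ring

lemma thetaConv_const_mul (θ : ℝ) (c : ℂ) (f g : Rn n → ℂ) :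
    thetaConv θ (fun x => c * f x) g = fun x => c * thetaConv θ f g x := by
  funext x
  simp only [thetaConv, mul_assoc, integral_const_mul]
  ring

lemma thetaDil_const_mul (θ r : ℝ) (c : ℂ) (f : Rn n → ℂ) :
    thetaDil θ r (fun x => c * f x) = fun x => c * thetaDil θ r f x := by
  funext x
  simp only [thetaDil, chirp, dil]
  ring

lemma thetaDil_thetaTrans (θ : ℝ) {r : ℝ} (hr : r ≠ 0) (t : Rn n) (h : Rn n → ℂ) :
    thetaDil θ r (thetaTrans θ t h) = fun x =>
      exp (((Real.pi * ⟪t, t⟫_ℝ * (1 - 1 / r ^ 2) * Real.cot θ : ℝ) : ℂ) * I) *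
        thetaTrans θ (r⁻¹ • t) (thetaDil θ r h) x := by
  funext x
  have hcot : Real.cot (-θ) = -Real.cot θ := by
    simp [Real.cot_eq_cos_div_sin, div_neg]
  simp only [thetaDil, chirp, dil, thetaTrans, hcot, smul_sub, smul_inv_smul₀ hr]
  have regroup : ∀ a b d k m : ℂ, a * (k * (b * (d * m))) = (a * b * d) * (k * m) := by
    intros; ring
  have regroup' : ∀ a b d e k m : ℂ,
      a * (b * (d * (k * (e * m)))) = (a * b * d * e) * (k * m) := by
    intros; ring
  rw [regroup, regroup']
  simp only [← Complex.exp_add, ← add_mul, ← Complex.ofReal_add]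
  congr 4
  simp only [inner_sub_right, inner_sub_left, real_inner_smul_left, real_inner_smul_right,
    real_inner_comm x t]
  field_simp
  ring

lemma layerU_phase_thetaTrans (θ : ℝ) {Λ : ℕ → Type} (g : ∀ k, Λ k → Rn n → ℂ)
    (M P : ℕ → (Rn n → ℂ) → Rn n → ℂ) (s : ℕ → ℝ) (k : ℕ) (hs : s k ≠ 0) (l : Λ k)
    (hM : ∀ u h, M k (thetaTrans θ u h) = thetaTrans θ u (M k h))
    (hP : ∀ u h, P k (thetaTrans θ u h) = thetaTrans θ u (P k h))
    (t v : Rn n) {a : ℝ} (ha : 0 ≤ a) (f : Rn n → ℂ) :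
    layerU θ g M P s k l
        (fun x => exp (((Real.pi * ⟪t, t⟫_ℝ * a * Real.cot θ : ℝ) : ℂ) * I) *
          thetaTrans θ v f x) =
      fun x => exp (((Real.pi * ⟪t, t⟫_ℝ * a * Real.cot θ : ℝ) : ℂ) * I) *
        (exp (((Real.pi * ⟪v, v⟫_ℝ * (1 - 1 / s k ^ 2) * Real.cot θ : ℝ) : ℂ) * I) *
          thetaTrans θ ((s k)⁻¹ • v) (layerU θ g M P s k l f) x) := by
  simp only [layerU]
  rw [thetaConv_const_mul, thetaConv_thetaTrans, map_phase_mul_of_comm hM t ha, hM,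
    map_phase_mul_of_comm hP t ha, hP, thetaDil_const_mul, thetaDil_thetaTrans θ hs]

lemma pathU_thetaTrans (θ : ℝ) {Λ : ℕ → Type} (g : ∀ k, Λ k → Rn n → ℂ)
    (M P : ℕ → (Rn n → ℂ) → Rn n → ℂ) (s : ℕ → ℝ) (hs : ∀ k, 1 ≤ s k) (N : ℕ)
    (hM : ∀ k, k < N → ∀ u h, M k (thetaTrans θ u h) = thetaTrans θ u (M k h))
    (hP : ∀ k, k < N → ∀ u h, P k (thetaTrans θ u h) = thetaTrans θ u (P k h))
    (q : ∀ j : Fin N, Λ j) (t : Rn n) (f : Rn n → ℂ) :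
    pathU θ g M P s N q (thetaTrans θ t f) = fun x =>
      exp (((Real.pi * ⟪t, t⟫_ℝ * (1 - 1 / (∏ j ∈ Finset.range N, s j) ^ 2) *
          Real.cot θ : ℝ) : ℂ) * I) *
        thetaTrans θ ((∏ j ∈ Finset.range N, s j)⁻¹ • t) (pathU θ g M P s N q f) x := by
  induction N with
  | zero => simp [pathU]
  | succ N ih =>
    have hS : 1 ≤ ∏ j ∈ Finset.range N, s j := Finset.one_le_prod fun j _ => hs j
    have hS0 : ∏ j ∈ Finset.range N, s j ≠ 0 := by positivity
    have hs0 : s N ≠ 0 := (zero_lt_one.trans_le (hs N)).ne'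
    have ha : 0 ≤ 1 - 1 / (∏ j ∈ Finset.range N, s j) ^ 2 :=
      sub_nonneg.2 (div_le_one_of_le₀ (one_le_pow₀ hS) (by positivity))
    simp only [pathU]
    rw [ih (fun k hk => hM k (by omega)) (fun k hk => hP k (by omega)),
      layerU_phase_thetaTrans θ g M P s N hs0 _ (hM N (by omega)) (hP N (by omega)) t _ ha]
    funext x
    rw [← mul_assoc, ← Complex.exp_add, ← add_mul, ← Complex.ofReal_add, smul_smul, ← mul_inv,
      Finset.prod_range_succ, mul_comm (s N)]
    congr 4
    rw [real_inner_smul_left, real_inner_smul_right]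
    field_simp
    ring

/-- In a θ-module sequence with pooling factors `s_k ≥ 1` whose
non-linearities and pooling operators commute with all θ-translations in the first `N` layers,
for every path `q ∈ Λ^N`, `t ∈ ℝⁿ` and `f ∈ L²(ℝⁿ)`:
`U^θ[q](T_t^θ f) = e^{πi (t·t)(1 - 1/(s₁⋯s_N)²) cot θ} T^θ_{t/(s₁⋯s_N)} U^θ[q] f`. -/
theorem statement6 (n : ℕ) (hn : 1 ≤ n) (θ : ℝ) (hθ : Real.sin θ ≠ 0)
    (Λ : ℕ → Type) [∀ k, Countable (Λ k)]
    (g : ∀ k, Λ k → Rn n → ℂ)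
    (hg1 : ∀ k l, Integrable (g k l) (volume : Measure (Rn n)))
    (hg2 : ∀ k l, MemLp (g k l) 2 (volume : Measure (Rn n)))
    (A B : ℕ → ℝ) (hAB : ∀ k, 0 < A k ∧ A k ≤ B k)
    (hframe : ∀ k, ∀ f : Rn n → ℂ, MemLp f 2 (volume : Measure (Rn n)) →
      ENNReal.ofReal (A k) * lNormSq f ≤
          (∑' l : Λ k, ∫⁻ u : Rn n,
            (‖L2inner (thetaTrans θ u (reflFun (g k l))) f‖₊ : ℝ≥0∞) ^ 2) ∧
        (∑' l : Λ k, ∫⁻ u : Rn n,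
            (‖L2inner (thetaTrans θ u (reflFun (g k l))) f‖₊ : ℝ≥0∞) ^ 2) ≤
          ENNReal.ofReal (B k) * lNormSq f)
    (M P : ℕ → (Rn n → ℂ) → Rn n → ℂ) (L R : ℕ → ℝ)
    (hMLip : ∀ k (h₁ h₂ : Rn n → ℂ),
      eLpNorm (M k h₁ - M k h₂) 2 (volume : Measure (Rn n)) ≤
        ENNReal.ofReal (L k) * eLpNorm (h₁ - h₂) 2 (volume : Measure (Rn n)))
    (hPLip : ∀ k (h₁ h₂ : Rn n → ℂ),
      eLpNorm (P k h₁ - P k h₂) 2 (volume : Measure (Rn n)) ≤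
        ENNReal.ofReal (R k) * eLpNorm (h₁ - h₂) 2 (volume : Measure (Rn n)))
    (hM0 : ∀ k, M k 0 =ᵐ[(volume : Measure (Rn n))] (0 : Rn n → ℂ))
    (hP0 : ∀ k, P k 0 =ᵐ[(volume : Measure (Rn n))] (0 : Rn n → ℂ))
    (s : ℕ → ℝ) (hs : ∀ k, 1 ≤ s k)
    (N : ℕ)
    (hMcomm : ∀ k, k < N → ∀ (u : Rn n) (h : Rn n → ℂ),
      M k (thetaTrans θ u h) = thetaTrans θ u (M k h))
    (hPcomm : ∀ k, k < N → ∀ (u : Rn n) (h : Rn n → ℂ),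
      P k (thetaTrans θ u h) = thetaTrans θ u (P k h))
    (q : ∀ j : Fin N, Λ j) (t : Rn n)
    (f : Rn n → ℂ) (hf : MemLp f 2 (volume : Measure (Rn n))) :
    pathU θ g M P s N q (thetaTrans θ t f) =ᵐ[(volume : Measure (Rn n))]
      fun x =>
        Complex.exp
          (((Real.pi * ⟪t, t⟫_ℝ * (1 - 1 / (∏ j ∈ Finset.range N, s j) ^ 2) * Real.cot θ : ℝ) : ℂ) *
            Complex.I) *
        thetaTrans θ ((∏ j ∈ Finset.range N, s j)⁻¹ • t) (pathU θ g M P s N q f) x := by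
  exact Filter.EventuallyEq.of_eq (pathU_thetaTrans θ g M P s hs N hMcomm hPcomm q t f)
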